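/- arXiv:1601.05868 — 7 statements merged into one kernel-verified Lean document; each statement's English description precedes it below -/
import Mathlib

section
/- For all quantization rates R_u, R_v > 0 and every correlation coefficient ρ with 0 < ρ² < 1, one has the identity e^{−2𝓡(R_u,R_v,ρ)} − e^{−2𝓡(R_v,R_u,ρ)} = ρ²·( 1/(e^{2R_v}(e^{2R_v} − 1)) − 1/(e^{2R_u}(e^{2R_u} − 1)) ). -/
/-- The achievable secret key rate in the two-terminal Gaussian model where terminal `u`
(quantization rate `Ru`) communicates publicly and terminal `v` (quantization rate `Rv`)
stays silent, with correlation coefficient `ρ` between the two sources. -/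
noncomputable def skRate (Ru Rv ρ : ℝ) : ℝ :=
  (1 / 2) * Real.log (Real.exp (2 * Ru) /
    ((Real.exp (2 * Ru) - 1) * (1 - ρ ^ 2) + 1 +
      ρ ^ 2 * Real.exp (2 * Ru) / (Real.exp (2 * Rv) - 1)))

theorem exp_neg_two_mul_skRate {Ru Rv ρ : ℝ} (hRu : 0 < Ru) (hRv : 0 < Rv) (hρ : ρ ^ 2 < 1) :
    Real.exp (-(2 * skRate Ru Rv ρ)) =
      (1 - ρ ^ 2) + ρ ^ 2 / Real.exp (2 * Ru) + ρ ^ 2 / (Real.exp (2 * Rv) - 1) := by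
  have ha : 0 < Real.exp (2 * Ru) - 1 := sub_pos.2 (Real.one_lt_exp_iff.2 (by linarith))
  have hb : 0 < Real.exp (2 * Rv) - 1 := sub_pos.2 (Real.one_lt_exp_iff.2 (by linarith))
  have hr : 0 < 1 - ρ ^ 2 := sub_pos.2 hρ
  have hD : 0 < (Real.exp (2 * Ru) - 1) * (1 - ρ ^ 2) + 1 +
      ρ ^ 2 * Real.exp (2 * Ru) / (Real.exp (2 * Rv) - 1) := by positivity
  rw [skRate, ← mul_assoc, mul_one_div_cancel two_ne_zero, one_mul, Real.exp_neg,
    Real.exp_log (div_pos (Real.exp_pos _) hD), inv_div]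
  have hane := (Real.exp_pos (2 * Ru)).ne'
  have hbne := hb.ne'
  field_simp
  ring

theorem skRate_exp_neg_two_mul_sub (Ru Rv ρ : ℝ) (hRu : 0 < Ru) (hRv : 0 < Rv)
    (hρ0 : 0 < ρ ^ 2) (hρ1 : ρ ^ 2 < 1) :
    Real.exp (-(2 * skRate Ru Rv ρ)) - Real.exp (-(2 * skRate Rv Ru ρ)) =
      ρ ^ 2 * (1 / (Real.exp (2 * Rv) * (Real.exp (2 * Rv) - 1)) -
        1 / (Real.exp (2 * Ru) * (Real.exp (2 * Ru) - 1))) := by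
  rw [exp_neg_two_mul_skRate hRu hRv hρ1, exp_neg_two_mul_skRate hRv hRu hρ1]
  have hu : Real.exp (2 * Ru) - 1 ≠ 0 := (sub_pos.2 (Real.one_lt_exp_iff.2 (by linarith))).ne'
  have hv : Real.exp (2 * Rv) - 1 ≠ 0 := (sub_pos.2 (Real.one_lt_exp_iff.2 (by linarith))).ne'
  have hu' := (Real.exp_pos (2 * Ru)).ne'
  have hv' := (Real.exp_pos (2 * Rv)).ne'
  field_simp
  ring
end

section
/- For all quantization rates R_u, R_v > 0 with R_v > R_u and every correlation coefficient ρ with 0 < ρ² < 1, one has 𝓡(R_u,R_v,ρ) > 𝓡(R_v,R_u,ρ); that is, a strictly higher secret key rate is achieved when the terminal with the lower quantization rate is the one that communicates publicly. -/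
/-- The key rate written through the per-unit denominator, in which the two rates decouple. -/
theorem skRate_eq_neg_log (Ru Rv ρ : ℝ) :
    skRate Ru Rv ρ = -(1 / 2) * Real.log (1 - ρ ^ 2 +
      ρ ^ 2 * (1 / Real.exp (2 * Ru) + 1 / (Real.exp (2 * Rv) - 1))) := by
  have ha : Real.exp (2 * Ru) ≠ 0 := Real.exp_ne_zero _
  have key : (Real.exp (2 * Ru) - 1) * (1 - ρ ^ 2) + 1 +
      ρ ^ 2 * Real.exp (2 * Ru) / (Real.exp (2 * Rv) - 1) =
      Real.exp (2 * Ru) * (1 - ρ ^ 2 +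
        ρ ^ 2 * (1 / Real.exp (2 * Ru) + 1 / (Real.exp (2 * Rv) - 1))) := by
    rw [div_eq_mul_one_div (ρ ^ 2 * Real.exp (2 * Ru))]
    generalize 1 / (Real.exp (2 * Rv) - 1) = t
    field_simp
    ring
  rw [skRate, key, div_mul_cancel_left₀ ha, Real.log_inv]
  ring

theorem one_div_add_one_div_sub_one_lt {a b : ℝ} (ha : 1 < a) (hab : a < b) :
    1 / a + 1 / (b - 1) < 1 / b + 1 / (a - 1) := by
  have gap : ∀ x : ℝ, 1 < x → 1 / (x - 1) - 1 / x = 1 / (x * (x - 1)) := by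
    intro x hx
    have h₁ : x - 1 ≠ 0 := by linarith
    have h₂ : x ≠ 0 := by linarith
    field_simp
    ring
  have hlt : 1 / (b * (b - 1)) < 1 / (a * (a - 1)) :=
    one_div_lt_one_div_of_lt (mul_pos (by linarith) (by linarith)) (by nlinarith)
  linarith [gap a ha, gap b (ha.trans hab)]

/-- A strictly higher secret key rate is achieved when the terminal with the lower
quantization rate communicates publicly. -/
theorem skRate_lower_rate_communicates (Ru Rv ρ : ℝ) (hRu : 0 < Ru) (hRv : 0 < Rv)
    (hlt : Ru < Rv) (hρ0 : 0 < ρ ^ 2) (hρ1 : ρ ^ 2 < 1) :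
    skRate Rv Ru ρ < skRate Ru Rv ρ := by
  have ha : 1 < Real.exp (2 * Ru) := Real.one_lt_exp_iff.2 (by linarith)
  have hab : Real.exp (2 * Ru) < Real.exp (2 * Rv) := Real.exp_lt_exp.2 (by linarith)
  have hmul := mul_lt_mul_of_pos_left (one_div_add_one_div_sub_one_lt ha hab) hρ0
  have hpos : 0 < 1 / Real.exp (2 * Ru) + 1 / (Real.exp (2 * Rv) - 1) :=
    add_pos (by positivity) (one_div_pos.2 (by linarith))
  rw [skRate_eq_neg_log, skRate_eq_neg_log]
  have hlog := Real.log_lt_log (add_pos (sub_pos.2 hρ1) (mul_pos hρ0 hpos))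
    (add_lt_add_right hmul (1 - ρ ^ 2))
  linarith
end

section
/- For every correlation coefficient ρ with 0 < ρ² < 1, 𝓡(R_u,R_v,ρ) tends to (1/2)·ln( 1/(1 − ρ²) ) as both R_u → ∞ and R_v → ∞ (i.e., along the product of the at-top filters in the two rate variables); that is, in the fine quantization limit the two-terminal scheme attains the secret key capacity. -/
/-- In the fine quantization limit (both rates tending to infinity, along the product of
the at-top filters), the two-terminal scheme attains the secret key capacity. -/
theorem skRate_tendsto_capacity (ρ : ℝ) (hρ0 : 0 < ρ ^ 2) (hρ1 : ρ ^ 2 < 1) :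
    Filter.Tendsto (fun p : ℝ × ℝ => skRate p.1 p.2 ρ)
      (Filter.atTop ×ˢ Filter.atTop)
      (nhds ((1 / 2) * Real.log (1 / (1 - ρ ^ 2)))) := by
  have hexp : Filter.Tendsto (fun x : ℝ => Real.exp (2 * x)) Filter.atTop Filter.atTop :=
    Real.tendsto_exp_atTop.comp (Filter.tendsto_id.const_mul_atTop (by norm_num))
  have hu : Filter.Tendsto (fun p : ℝ × ℝ => (Real.exp (2 * p.1))⁻¹)
      (Filter.atTop ×ˢ Filter.atTop) (nhds 0) :=
    (tendsto_inv_atTop_zero.comp hexp).comp Filter.tendsto_fst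
  have hv : Filter.Tendsto (fun p : ℝ × ℝ => (Real.exp (2 * p.2) - 1)⁻¹)
      (Filter.atTop ×ˢ Filter.atTop) (nhds 0) :=
    (tendsto_inv_atTop_zero.comp
      (Filter.tendsto_atTop_add_const_right _ (-1) hexp)).comp Filter.tendsto_snd
  have hden : Filter.Tendsto (fun p : ℝ × ℝ =>
      (1 - (Real.exp (2 * p.1))⁻¹) * (1 - ρ ^ 2) + (Real.exp (2 * p.1))⁻¹ +
        ρ ^ 2 * (Real.exp (2 * p.2) - 1)⁻¹)
      (Filter.atTop ×ˢ Filter.atTop) (nhds (1 - ρ ^ 2)) := by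
    simpa using (((hu.const_sub 1).mul_const (1 - ρ ^ 2)).add hu).add (hv.const_mul (ρ ^ 2))
  have hpos : 0 < 1 - ρ ^ 2 := sub_pos.mpr hρ1
  have hlim := ((hden.inv₀ hpos.ne').log (inv_ne_zero hpos.ne')).const_mul (1 / 2)
  rw [← one_div] at hlim
  refine hlim.congr fun p => ?_
  have hne : Real.exp (2 * p.1) ≠ 0 := Real.exp_ne_zero _
  have hfactor : (Real.exp (2 * p.1) - 1) * (1 - ρ ^ 2) + 1 +
      ρ ^ 2 * Real.exp (2 * p.1) / (Real.exp (2 * p.2) - 1) =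
      Real.exp (2 * p.1) * ((1 - (Real.exp (2 * p.1))⁻¹) * (1 - ρ ^ 2) +
        (Real.exp (2 * p.1))⁻¹ + ρ ^ 2 * (Real.exp (2 * p.2) - 1)⁻¹) := by
    rw [div_eq_mul_inv]
    linear_combination (-ρ ^ 2) * mul_inv_cancel₀ hne
  rw [skRate, hfactor, div_mul_cancel_left₀ hne]
end

section
/- Fix a root r ∈ V and a family of quantization rates R : V → (0,∞). Define R_ent(r,R) := R(r) + Σ_{u ∈ V*_r, u ≠ r} (1/2)·ln( (e^{2R(u)} − 1)(1 − ρ_{u,parent(u)}²) + 1 ) and R_com(r,R) := Σ_{v ∈ V*_r} max_{u ∈ N_T(v)} (1/2)·ln( (e^{2R(v)} − 1)(1 − ρ_{uv}²) + 1 + ρ_{uv}²·e^{2R(v)}/(e^{2R(u)} − 1) ). Then, as all the rates R(v), v ∈ V, tend to infinity (along the product of at-top filters), R_ent(r,R) − R_com(r,R) converges to R∞(r) := min_{v ∈ N_T(r)} (1/2)·ln( 1/(1 − ρ_{rv}²) ) + Σ_{u ∈ V*_r, u ≠ r} min_{v ∈ N_T(u)} (1/2)·ln( (1 − ρ_{u,parent(u)}²)/(1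 − ρ_{uv}²) ). -/
/-- The vertex set of the rooted subtree `T*_r` obtained from `T` rooted at `r` by deleting
its leaves: equivalently, the set of vertices having at least one child. -/
def Vstar {V : Type*} [Fintype V] [DecidableEq V] (r : V) (parent : V → V) : Finset V :=
  Finset.univ.filter (fun u => ∃ v, v ≠ r ∧ parent v = u)

/-- Minimum of `f` over the neighbours of `u` in `G` (as an infimum of a finite
nonempty set of reals). -/
noncomputable def nbrMin {V : Type*} (G : SimpleGraph V) (u : V) (f : V → ℝ) : ℝ :=
  sInf (f '' G.neighborSet u)

/-- Maximum of `f` over the neighbours of `u` in `G`. -/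
noncomputable def nbrMax {V : Type*} (G : SimpleGraph V) (u : V) (f : V → ℝ) : ℝ :=
  sSup (f '' G.neighborSet u)

/-- `R_ent(r,R)`: lower bound on the joint entropy rate of the quantized sources. -/
noncomputable def Rent {V : Type*} [Fintype V] [DecidableEq V] (ρ : V → V → ℝ)
    (r : V) (parent : V → V) (R : V → ℝ) : ℝ :=
  R r + ∑ u ∈ (Vstar r parent).erase r,
    (1 / 2) * Real.log ((Real.exp (2 * R u) - 1) * (1 - ρ u (parent u) ^ 2) + 1)

/-- `R_com(r,R)`: upper bound on the total rate of public communication. -/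
noncomputable def Rcom {V : Type*} [Fintype V] [DecidableEq V] (G : SimpleGraph V)
    (ρ : V → V → ℝ) (r : V) (parent : V → V) (R : V → ℝ) : ℝ :=
  ∑ v ∈ Vstar r parent, nbrMax G v (fun u =>
    (1 / 2) * Real.log ((Real.exp (2 * R v) - 1) * (1 - ρ u v ^ 2) + 1 +
      ρ u v ^ 2 * Real.exp (2 * R v) / (Real.exp (2 * R u) - 1)))

/-- `R∞(r)`: the fine-quantization limit of the achievable secret key rate for root `r`. -/
noncomputable def Rinf {V : Type*} [Fintype V] [DecidableEq V] (G : SimpleGraph V)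
    (ρ : V → V → ℝ) (r : V) (parent : V → V) : ℝ :=
  nbrMin G r (fun v => (1 / 2) * Real.log (1 / (1 - ρ r v ^ 2))) +
    ∑ u ∈ (Vstar r parent).erase r,
      nbrMin G u (fun v =>
        (1 / 2) * Real.log ((1 - ρ u (parent u) ^ 2) / (1 - ρ u v ^ 2)))

open Filter Topology in
/-- At fine quantization, a log-term with correlation weight `c` exceeds its own rate `x`
by `(1 / 2) * log c` in the limit. -/
theorem tendsto_half_log_sub_rate {ι : Type*} {l : Filter ι} {x y : ι → ℝ}
    (hx : Tendsto x l atTop) (hy : Tendsto y l atTop) {c : ℝ} (hc : 0 < c) (d : ℝ) :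
    Tendsto (fun i => (1 / 2) * Real.log ((Real.exp (2 * x i) - 1) * c + 1 +
      d * Real.exp (2 * x i) / (Real.exp (2 * y i) - 1)) - x i) l
      (𝓝 ((1 / 2) * Real.log c)) := by
  have hexp : ∀ {z : ι → ℝ}, Tendsto z l atTop →
      Tendsto (fun i => Real.exp (2 * z i)) l atTop := fun hz =>
    Real.tendsto_exp_atTop.comp (hz.const_mul_atTop two_pos)
  have hx' := (hexp hx).inv_tendsto_atTop
  have hy' := (tendsto_atTop_add_const_right l (-1) (hexp hy)).inv_tendsto_atTop
  have hA : Tendsto (fun i => (1 - (Real.exp (2 * x i))⁻¹) * c + (Real.exp (2 * x i))⁻¹ +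
      d * (Real.exp (2 * y i) + -1)⁻¹) l (𝓝 c) := by
    simpa using (((hx'.const_sub 1).mul_const c).add hx').add (hy'.const_mul d)
  refine ((hA.log hc.ne').const_mul (1 / 2)).congr' ?_
  filter_upwards [hA.eventually_ne hc.ne'] with i hi
  have hfac : (Real.exp (2 * x i) - 1) * c + 1 +
      d * Real.exp (2 * x i) / (Real.exp (2 * y i) - 1) =
      Real.exp (2 * x i) * ((1 - (Real.exp (2 * x i))⁻¹) * c + (Real.exp (2 * x i))⁻¹ +
        d * (Real.exp (2 * y i) + -1)⁻¹) := by
    have := (Real.exp_pos (2 * x i)).ne'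
    rw [← sub_eq_add_neg, div_eq_mul_inv]
    linear_combination (c - 1) * mul_inv_cancel₀ this
  rw [hfac, Real.log_mul (Real.exp_pos _).ne' hi, Real.log_exp]
  ring

section nbr

variable {V : Type*} {G : SimpleGraph V} {u : V} {f g : V → ℝ}

theorem nbrMax_eq_sup' [Fintype (G.neighborSet u)] (h : (G.neighborFinset u).Nonempty) :
    nbrMax G u f = (G.neighborFinset u).sup' h f := by
  rw [Finset.sup'_eq_csSup_image, SimpleGraph.coe_neighborFinset, nbrMax]

theorem nbrMin_congr (h : ∀ v, G.Adj u v → f v = g v) : nbrMin G u f = nbrMin G u g := by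
  rw [nbrMin, nbrMin, Set.image_congr (s := G.neighborSet u) h]

theorem nbrMax_const_add [Finite V] (h : (G.neighborSet u).Nonempty) (c : ℝ) :
    nbrMax G u (fun v => c + f v) = c + nbrMax G u f := by
  have := (OrderIso.addLeft c).map_csSup' (h.image f) (Set.toFinite _).bddAbove
  rw [nbrMax, nbrMax, ← OrderIso.addLeft_apply, this, Set.image_image]
  rfl

theorem nbrMin_neg : nbrMin G u (fun v => -f v) = -nbrMax G u f := by
  rw [nbrMin, nbrMax, ← Real.sInf_neg, ← Set.image_neg_eq_neg, Set.image_image]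

theorem nbrMin_const_sub [Finite V] (h : (G.neighborSet u).Nonempty) (c : ℝ) :
    nbrMin G u (fun v => c - f v) = c - nbrMax G u f := by
  rw [← neg_neg c, sub_eq_add_neg, ← neg_add, ← nbrMax_const_add h, ← nbrMin_neg]
  exact nbrMin_congr fun _ _ => by ring

open Filter Topology in
theorem tendsto_nbrMax [Finite V] {ι : Type*} {l : Filter ι} {F : ι → V → ℝ}
    (h : (G.neighborSet u).Nonempty)
    (hF : ∀ v, G.Adj u v → Tendsto (fun i => F i v) l (𝓝 (f v))) :
    Tendsto (fun i => nbrMax G u (F i)) l (𝓝 (nbrMax G u f)) := by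
  have := Fintype.ofFinite (G.neighborSet u)
  have hne : (G.neighborFinset u).Nonempty := by
    rwa [← Finset.coe_nonempty, SimpleGraph.coe_neighborFinset]
  simp only [nbrMax_eq_sup' hne]
  exact Tendsto.finset_sup'_nhds_apply hne fun v hv =>
    hF v ((G.mem_neighborFinset u v).1 hv)

end nbr

theorem root_mem_Vstar {V : Type*} [Fintype V] [DecidableEq V] {G : SimpleGraph V}
    (hconn : G.Connected) (hcard : 2 ≤ Fintype.card V) {r : V} {parent : V → V}
    (hdist : ∀ u, u ≠ r → G.dist (parent u) r + 1 = G.dist u r) : r ∈ Vstar r parent := by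
  have : Nontrivial V := Fintype.one_lt_card_iff_nontrivial.1 hcard
  obtain ⟨v, hv⟩ := hconn.preconnected.exists_adj_of_nontrivial r
  refine Finset.mem_filter.2 ⟨Finset.mem_univ r, v, hv.ne', ?_⟩
  have h := hdist v hv.ne'
  rw [SimpleGraph.dist_eq_one_iff_adj.2 hv.symm] at h
  exact hconn.dist_eq_zero_iff.1 (by omega)

/-- As all quantization rates tend to infinity, `R_ent(r,R) − R_com(r,R)` converges to
`R∞(r)`. -/
theorem rent_sub_rcom_tendsto_rinf {V : Type*} [Fintype V] [DecidableEq V]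
    (G : SimpleGraph V) (hconn : G.Connected) (hacyc : G.IsAcyclic)
    (hcard : 2 ≤ Fintype.card V)
    (ρ : V → V → ℝ) (hsym : ∀ u v, ρ u v = ρ v u)
    (hρ : ∀ u v, G.Adj u v → (ρ u v) ^ 2 < 1)
    (r : V) (parent : V → V)
    (hadj : ∀ u, u ≠ r → G.Adj u (parent u))
    (hdist : ∀ u, u ≠ r → G.dist (parent u) r + 1 = G.dist u r) :
    Filter.Tendsto (fun R : V → ℝ => Rent ρ r parent R - Rcom G ρ r parent R)
      (Filter.pi fun _ : V => Filter.atTop)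
      (nhds (Rinf G ρ r parent)) := by
  have : Nontrivial V := Fintype.one_lt_card_iff_nontrivial.1 hcard
  have hne : ∀ u, (G.neighborSet u).Nonempty :=
    fun u => hconn.preconnected.exists_adj_of_nontrivial u
  have hpos : ∀ u v, G.Adj u v → 0 < 1 - ρ u v ^ 2 := fun u v h => sub_pos.2 (hρ u v h)
  have hR : ∀ v, Filter.Tendsto (fun R : V → ℝ => R v)
      (Filter.pi fun _ : V => Filter.atTop) Filter.atTop := fun v => Filter.tendsto_eval_pi _ v
  have hcom : ∀ v, Filter.Tendsto (fun R : V → ℝ => nbrMax G v (fun u =>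
      (1 / 2) * Real.log ((Real.exp (2 * R v) - 1) * (1 - ρ u v ^ 2) + 1 +
        ρ u v ^ 2 * Real.exp (2 * R v) / (Real.exp (2 * R u) - 1))) - R v)
      (Filter.pi fun _ : V => Filter.atTop)
      (nhds (nbrMax G v fun u => (1 / 2) * Real.log (1 - ρ v u ^ 2))) := fun v => by
    simp_rw [sub_eq_neg_add _ (_ : ℝ), ← nbrMax_const_add (hne v), ← sub_eq_neg_add]
    refine tendsto_nbrMax (hne v) fun u hu => ?_
    simp_rw [hsym u v]
    exact tendsto_half_log_sub_rate (hR v) (hR u) (hpos v u hu) _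
  have hent : ∀ u ∈ (Vstar r parent).erase r, Filter.Tendsto (fun R : V → ℝ =>
      (1 / 2) * Real.log ((Real.exp (2 * R u) - 1) * (1 - ρ u (parent u) ^ 2) + 1) - R u)
      (Filter.pi fun _ : V => Filter.atTop)
      (nhds ((1 / 2) * Real.log (1 - ρ u (parent u) ^ 2))) := fun u hu => by
    simpa using tendsto_half_log_sub_rate (hR u) (hR u)
      (hpos _ _ (hadj u (Finset.ne_of_mem_erase hu))) 0
  have hroot : nbrMin G r (fun v => (1 / 2) * Real.log (1 / (1 - ρ r v ^ 2))) =
      -nbrMax G r fun v => (1 / 2) * Real.log (1 - ρ r v ^ 2) := by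
    simp only [← nbrMin_neg, one_div, Real.log_inv, mul_neg]
  have hinner : ∀ u ∈ (Vstar r parent).erase r, nbrMin G u (fun v =>
      (1 / 2) * Real.log ((1 - ρ u (parent u) ^ 2) / (1 - ρ u v ^ 2))) =
      (1 / 2) * Real.log (1 - ρ u (parent u) ^ 2) -
        nbrMax G u fun v => (1 / 2) * Real.log (1 - ρ u v ^ 2) := fun u hu => by
    rw [← nbrMin_const_sub (hne u)]
    refine nbrMin_congr fun v hv => ?_
    rw [Real.log_div (hpos _ _ (hadj u (Finset.ne_of_mem_erase hu))).ne' (hpos _ _ hv).ne',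
      mul_sub]
  rw [Rinf, hroot, Finset.sum_congr rfl hinner]
  refine ((hcom r).neg.add (tendsto_finsetSum _ fun u hu =>
    (hent u hu).sub (hcom u))).congr fun R => ?_
  rw [Rent, Rcom, ← Finset.add_sum_erase _ _ (root_mem_Vstar hconn hcard hdist)]
  simp only [sub_sub_sub_cancel_right, Finset.sum_sub_distrib]
  ring
end

section
/- Suppose there is a root r ∈ V such that for every u ∈ V*_r with u ≠ r and every neighbour v ∈ N_T(u), one has ρ_{u,parent(u)}² ≤ ρ_{uv}² (i.e., the parent edge minimizes the squared correlation among all edges incident to u). Then R∞(r) = C∞ := min_{(u,v) ∈ E} (1/2)·ln( 1/(1 − ρ_{uv}²) ); in particular the minimizing edge of C∞ can be taken incident to r, every non-root summand of R∞(r) vanishes, and the fine-quantization achievable rate attains the secret key capacity. -/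
/-- In a finite tree rooted at `r`, every edge joins a non-root vertex to its parent. -/
theorem exists_eq_parent_of_adj {V : Type*} [Fintype V] (G : SimpleGraph V) (hG : G.IsTree)
    (r : V) (parent : V → V) (hadj : ∀ u, u ≠ r → G.Adj u (parent u))
    (hdist : ∀ u, u ≠ r → G.dist (parent u) r + 1 = G.dist u r) {a b : V} (hab : G.Adj a b) :
    (a ≠ r ∧ parent a = b) ∨ (b ≠ r ∧ parent b = a) := by
  classical
  have hinj : Set.InjOn (fun u => s(u, parent u)) (Finset.univ.erase r : Finset V) := by
    intro u hu w hw h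
    have hu' : u ≠ r := by simpa using hu
    have hw' : w ≠ r := by simpa using hw
    rcases Sym2.eq_iff.mp h with h | ⟨h₁, h₂⟩
    · exact h.1
    · have h₃ := hdist u hu'
      have h₄ := hdist w hw'
      rw [h₂] at h₃
      rw [← h₁] at h₄
      omega
  have himage : (Finset.univ.erase r).image (fun u => s(u, parent u)) = G.edgeFinset := by
    refine Finset.eq_of_subset_of_card_le ?_ ?_
    · intro e he
      obtain ⟨u, hu, rfl⟩ := Finset.mem_image.mp he
      simpa using hadj u (by simpa using hu)
    · rw [Finset.card_image_of_injOn hinj, Finset.card_erase_of_mem (Finset.mem_univ r),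
        Finset.card_univ, ← hG.card_edgeFinset]
      simp
  have hmem : s(a, b) ∈ (Finset.univ.erase r).image (fun u => s(u, parent u)) := by
    rw [himage]
    simpa using hab
  obtain ⟨u, hu, he⟩ := Finset.mem_image.mp hmem
  have hu' : u ≠ r := by simpa using hu
  rcases Sym2.eq_iff.mp he with ⟨rfl, h⟩ | ⟨rfl, h⟩
  · exact Or.inl ⟨hu', h⟩
  · exact Or.inr ⟨hu', h⟩

/-- If parent edges minimize the squared correlation at internal vertices, then every parent
edge is bounded below by some edge incident to the root. -/
theorem exists_root_edge_sq_le {V : Type*} [Fintype V] [DecidableEq V] (G : SimpleGraph V)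
    (ρ : V → V → ℝ) (hsym : ∀ u v, ρ u v = ρ v u) (r : V) (parent : V → V)
    (hadj : ∀ u, u ≠ r → G.Adj u (parent u))
    (hdist : ∀ u, u ≠ r → G.dist (parent u) r + 1 = G.dist u r)
    (hmin : ∀ u ∈ Vstar r parent, u ≠ r →
      ∀ v, G.Adj u v → ρ u (parent u) ^ 2 ≤ ρ u v ^ 2) (u : V) (hu : u ≠ r) :
    ∃ v, G.Adj r v ∧ ρ r v ^ 2 ≤ ρ u (parent u) ^ 2 := by
  induction hn : G.dist u r using Nat.strong_induction_on generalizing u with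
  | _ n ih =>
    by_cases hp : parent u = r
    · exact ⟨u, hp ▸ (hadj u hu).symm, by rw [hp, hsym]⟩
    · obtain ⟨v, hv, hle⟩ := ih _ (by have := hdist u hu; omega) (parent u) hp rfl
      refine ⟨v, hv, hle.trans ?_⟩
      rw [hsym u]
      exact hmin _ (Finset.mem_filter.mpr ⟨Finset.mem_univ _, u, hu, rfl⟩) hp u
        (hadj u hu).symm

/-- The Gaussian mutual information `(1 / 2) log (1 / (1 - x))` is monotone in the squared
correlation `x < 1`. -/
theorem half_log_one_div_one_sub_le {x y : ℝ} (hxy : x ≤ y) (hy : y < 1) :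
    (1 / 2) * Real.log (1 / (1 - x)) ≤ (1 / 2) * Real.log (1 / (1 - y)) := by
  have hy' : 0 < 1 - y := by linarith
  have hx' : 0 < 1 - x := by linarith
  gcongr

/-- If the parent edge minimizes the squared correlation among all edges incident to every
non-root vertex of `T*_r`, then `R∞(r)` attains the secret key capacity `C∞`: the minimizing
edge of `C∞` can be taken incident to `r`, every non-root summand of `R∞(r)` vanishes, and
`R∞(r) = C∞`. -/
theorem rinf_eq_capacity_of_parent_min {V : Type*} [Fintype V] [DecidableEq V]
    (G : SimpleGraph V) (hconn : G.Connected) (hacyc : G.IsAcyclic)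
    (hcard : 2 ≤ Fintype.card V)
    (ρ : V → V → ℝ) (hsym : ∀ u v, ρ u v = ρ v u)
    (hρ : ∀ u v, G.Adj u v → (ρ u v) ^ 2 < 1)
    (r : V) (parent : V → V)
    (hadj : ∀ u, u ≠ r → G.Adj u (parent u))
    (hdist : ∀ u, u ≠ r → G.dist (parent u) r + 1 = G.dist u r)
    (hmin : ∀ u ∈ Vstar r parent, u ≠ r →
      ∀ v, G.Adj u v → ρ u (parent u) ^ 2 ≤ ρ u v ^ 2) :
    (∃ v, G.Adj r v ∧
      sInf {x : ℝ | ∃ a b, G.Adj a b ∧ x = (1 / 2) * Real.log (1 / (1 - ρ a b ^ 2))} =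
        (1 / 2) * Real.log (1 / (1 - ρ r v ^ 2))) ∧
    (∀ u ∈ (Vstar r parent).erase r,
      nbrMin G u (fun v =>
        (1 / 2) * Real.log ((1 - ρ u (parent u) ^ 2) / (1 - ρ u v ^ 2))) = 0) ∧
    Rinf G ρ r parent =
      sInf {x : ℝ | ∃ a b, G.Adj a b ∧ x = (1 / 2) * Real.log (1 / (1 - ρ a b ^ 2))} := by
  have hG : G.IsTree := ⟨hconn, hacyc⟩
  have hroot : ∀ a b, G.Adj a b → ∃ v, G.Adj r v ∧ ρ r v ^ 2 ≤ ρ a b ^ 2 := by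
    intro a b hab
    rcases exists_eq_parent_of_adj G hG r parent hadj hdist hab with ⟨ha, rfl⟩ | ⟨hb, rfl⟩
    · exact exists_root_edge_sq_le G ρ hsym r parent hadj hdist hmin a ha
    · rw [hsym]
      exact exists_root_edge_sq_le G ρ hsym r parent hadj hdist hmin b hb
  obtain ⟨w, hw⟩ := Fintype.exists_ne_of_one_lt_card (by omega : 1 < Fintype.card V) r
  obtain ⟨v₀, hv₀, -⟩ := hroot w _ (hadj w hw)
  obtain ⟨v, hv, hvmin⟩ := Set.exists_min_image (G.neighborSet r) (fun v => ρ r v ^ 2)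
    (Set.toFinite _) ⟨v₀, hv₀⟩
  have hcap : IsLeast
      {x : ℝ | ∃ a b, G.Adj a b ∧ x = (1 / 2) * Real.log (1 / (1 - ρ a b ^ 2))}
      ((1 / 2) * Real.log (1 / (1 - ρ r v ^ 2))) := by
    refine ⟨⟨r, v, hv, rfl⟩, ?_⟩
    rintro _ ⟨a, b, hab, rfl⟩
    obtain ⟨c, hc, hle⟩ := hroot a b hab
    exact half_log_one_div_one_sub_le ((hvmin c hc).trans hle) (hρ a b hab)
  have hr : nbrMin G r (fun v => (1 / 2) * Real.log (1 / (1 - ρ r v ^ 2))) =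
      (1 / 2) * Real.log (1 / (1 - ρ r v ^ 2)) := by
    refine IsLeast.csInf_eq ⟨⟨v, hv, rfl⟩, ?_⟩
    rintro _ ⟨c, hc, rfl⟩
    exact half_log_one_div_one_sub_le (hvmin c hc) (hρ r c hc)
  have hzero : ∀ u ∈ (Vstar r parent).erase r,
      nbrMin G u (fun v =>
        (1 / 2) * Real.log ((1 - ρ u (parent u) ^ 2) / (1 - ρ u v ^ 2))) = 0 := by
    intro u hu
    obtain ⟨hur, hus⟩ := Finset.mem_erase.mp hu
    have hp := hadj u hur
    have hpos : 0 < 1 - ρ u (parent u) ^ 2 := sub_pos.mpr (hρ u _ hp)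
    refine IsLeast.csInf_eq ⟨⟨parent u, hp, ?_⟩, ?_⟩
    · simp [div_self hpos.ne']
    · rintro _ ⟨c, hc, rfl⟩
      have hcpos : 0 < 1 - ρ u c ^ 2 := sub_pos.mpr (hρ u c hc)
      have hle := hmin u hus hur c hc
      refine mul_nonneg (by norm_num) (Real.log_nonneg ?_)
      rw [one_le_div hcpos]
      linarith
  refine ⟨⟨v, hv, hcap.csInf_eq⟩, hzero, ?_⟩
  rw [Rinf, Finset.sum_eq_zero hzero, add_zero, hr, hcap.csInf_eq]
end

section
/- Let T be the path on four vertices 1–2–3–4 with edge correlations ρ_{12} = ρ_{34} = a and ρ_{23} = b, where 0 < a < b < 1. Then the fine-quantization achievable rate satisfies R∞ := max_{r ∈ {1,2,3,4}} R∞(r) < (1/2)·ln( 1/(1 − a²) ) = C∞; that is, the scheme is strictly suboptimal on this Markov chain even in the fine quantization limit. -/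
/-- The path graph on four vertices `0 – 1 – 2 – 3`. -/
def pathG : SimpleGraph (Fin 4) := SimpleGraph.fromRel (fun u v => u.val + 1 = v.val)

/-- The parent map for the path `0 – 1 – 2 – 3` rooted at `r`: each vertex moves one step
towards the root. -/
def parentP (r u : Fin 4) : Fin 4 :=
  if h : u.val < r.val then ⟨u.val + 1, by have := r.isLt; omega⟩
  else ⟨u.val - 1, by have := u.isLt; omega⟩

/-- Edge correlations on the path `0 – 1 – 2 – 3`: the two outer edges `(0,1)` and `(2,3)`
carry correlation `a`, and the middle edge `(1,2)` carries correlation `b`. -/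
def ρPath (a b : ℝ) (u v : Fin 4) : ℝ := if u.val + v.val = 3 then b else a

theorem pathG_adj_iff (u v : Fin 4) :
    pathG.Adj u v ↔ u.val + 1 = v.val ∨ v.val + 1 = u.val := by
  simp only [pathG, SimpleGraph.fromRel_adj]
  refine ⟨And.right, fun h => ⟨?_, h⟩⟩
  rintro rfl
  omega

theorem nbrMin_eq_of_singleton {V : Type*} {G : SimpleGraph V} {u v : V}
    (h : G.neighborSet u = {v}) (f : V → ℝ) : nbrMin G u f = f v := by
  simp [nbrMin, h]

theorem nbrMin_eq_of_pair {V : Type*} {G : SimpleGraph V} {u v w : V}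
    (h : G.neighborSet u = {v, w}) (f : V → ℝ) : nbrMin G u f = min (f v) (f w) := by
  rw [nbrMin, h, Set.image_pair, csInf_pair]

theorem pathG_neighborSet_zero : pathG.neighborSet 0 = {1} := by
  ext v
  fin_cases v <;> simp [pathG_adj_iff]

theorem pathG_neighborSet_one : pathG.neighborSet 1 = {0, 2} := by
  ext v
  fin_cases v <;> simp [pathG_adj_iff]

theorem pathG_neighborSet_two : pathG.neighborSet 2 = {1, 3} := by
  ext v
  fin_cases v <;> simp [pathG_adj_iff]

theorem pathG_neighborSet_three : pathG.neighborSet 3 = {2} := by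
  ext v
  fin_cases v <;> simp [pathG_adj_iff]

/-- For every root, the rate on the path falls short of the outer-edge rate by exactly the
difference of the middle-edge and outer-edge rates. -/
theorem Rinf_pathG (a b : ℝ) (ha : 0 < a) (hab : a < b) (hb : b < 1) (r : Fin 4) :
    Rinf pathG (ρPath a b) r (parentP r) =
      (Real.log (1 - b ^ 2) - Real.log (1 - a ^ 2)) / 2 - Real.log (1 - a ^ 2) / 2 := by
  have hA : 0 < 1 - a ^ 2 := by nlinarith
  have hB : 0 < 1 - b ^ 2 := by nlinarith
  have hBA : Real.log (1 - b ^ 2) < Real.log (1 - a ^ 2) :=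
    Real.log_lt_log hB (by nlinarith)
  have e0 : (Vstar 0 (parentP 0)).erase 0 = {1, 2} := by decide
  have e1 : (Vstar 1 (parentP 1)).erase 1 = {2} := by decide
  have e2 : (Vstar 2 (parentP 2)).erase 2 = {1} := by decide
  have e3 : (Vstar 3 (parentP 3)).erase 3 = {1, 2} := by decide
  have p01 : parentP 0 1 = 0 := by decide
  have p02 : parentP 0 2 = 1 := by decide
  have p12 : parentP 1 2 = 1 := by decide
  have p21 : parentP 2 1 = 2 := by decide
  have p31 : parentP 3 1 = 2 := by decide
  have p32 : parentP 3 2 = 3 := by decide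
  have r01 : ρPath a b 0 1 = a := by simp [ρPath]
  have r10 : ρPath a b 1 0 = a := by simp [ρPath]
  have r12 : ρPath a b 1 2 = b := by simp [ρPath]
  have r21 : ρPath a b 2 1 = b := by simp [ρPath]
  have r23 : ρPath a b 2 3 = a := by simp [ρPath]
  have r32 : ρPath a b 3 2 = a := by simp [ρPath]
  have n12 : (1 : Fin 4) ≠ 2 := by decide
  fin_cases r <;>
    simp only [Fin.zero_eta, Fin.mk_one, Fin.reduceFinMk, Rinf, e0, e1, e2, e3,
      Finset.sum_pair n12, Finset.sum_singleton, nbrMin_eq_of_singleton pathG_neighborSet_zero,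
      nbrMin_eq_of_pair pathG_neighborSet_one, nbrMin_eq_of_pair pathG_neighborSet_two,
      nbrMin_eq_of_singleton pathG_neighborSet_three, p01, p02, p12, p21, p31, p32,
      r01, r10, r12, r21, r23, r32, Real.log_div one_ne_zero hA.ne',
      Real.log_div one_ne_zero hB.ne', Real.log_div hA.ne' hA.ne', Real.log_div hA.ne' hB.ne',
      Real.log_div hB.ne' hA.ne', Real.log_div hB.ne' hB.ne', Real.log_one] <;>
    grind

/-- On the Markov chain `1 – 2 – 3 – 4` with `ρ₁₂ = ρ₃₄ = a` and `ρ₂₃ = b`, `0 < a < b < 1`,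
the fine-quantization achievable rate `max_r R∞(r)` is strictly below the secret key capacity
`C∞ = (1/2)·ln(1/(1 − a²))`. -/
theorem rinf_lt_capacity_path_four (a b : ℝ) (ha : 0 < a) (hab : a < b) (hb : b < 1) :
    sSup (Set.range fun r : Fin 4 => Rinf pathG (ρPath a b) r (parentP r)) <
      (1 / 2) * Real.log (1 / (1 - a ^ 2)) ∧
    (1 / 2) * Real.log (1 / (1 - a ^ 2)) =
      sInf {x : ℝ | ∃ u v, pathG.Adj u v ∧
        x = (1 / 2) * Real.log (1 / (1 - ρPath a b u v ^ 2))} := by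
  have hA : 0 < 1 - a ^ 2 := by nlinarith
  have hB : 0 < 1 - b ^ 2 := by nlinarith
  have hBA : Real.log (1 - b ^ 2) < Real.log (1 - a ^ 2) :=
    Real.log_lt_log hB (by nlinarith)
  constructor
  · simp only [Rinf_pathG a b ha hab hb, Set.range_const, csSup_singleton,
      Real.log_div one_ne_zero hA.ne', Real.log_one]
    linarith
  · symm
    apply IsLeast.csInf_eq
    refine ⟨⟨0, 1, by simp [pathG_adj_iff], by simp [ρPath]⟩, ?_⟩
    rintro x ⟨u, v, -, rfl⟩
    unfold ρPath
    split_ifs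
    · rw [Real.log_div one_ne_zero hA.ne', Real.log_div one_ne_zero hB.ne']
      linarith
    · exact le_rfl
end

section
/- Let Λ be a lattice in ℝⁿ (a discrete additive subgroup spanning ℝⁿ) and let F ⊆ ℝⁿ be a measurable fundamental domain for the translation action of Λ on ℝⁿ, of finite positive Lebesgue volume; let ψ : ℝⁿ → F denote the reduction map sending each x ∈ ℝⁿ to the unique point of F in the coset x + Λ. If X is any ℝⁿ-valued random vector and D is a random vector uniformly distributed on F and independent of X, then ψ(X + D) is uniformly distributed on F and is independent of X. -/
open MeasureTheory ProbabilityTheory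

/-- A measurable set of unique coset representatives of `Λ` is a fundamental domain. -/
theorem isAddFundamentalDomain_of_existsUnique_rep {n : ℕ} (Λ : AddSubgroup (Fin n → ℝ))
    {F : Set (Fin n → ℝ)} (hF : MeasurableSet F)
    (hFfund : ∀ x : Fin n → ℝ, ∃! f, f ∈ F ∧ x - f ∈ Λ) :
    IsAddFundamentalDomain Λ F := by
  refine IsAddFundamentalDomain.mk' hF.nullMeasurableSet fun x => ?_
  obtain ⟨f, ⟨hf, hxf⟩, huniq⟩ := hFfund x
  refine ⟨⟨f - x, by simpa using Λ.neg_mem hxf⟩, ?_, fun g hg => ?_⟩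
  · simpa [AddSubgroup.vadd_def] using hf
  · have hgx : (g : Fin n → ℝ) + x ∈ F := hg
    exact Subtype.ext (eq_sub_of_add_eq (huniq _ ⟨hgx, by simp⟩))

open scoped Pointwise in
/-- Translating and then reducing modulo `Λ` preserves Lebesgue measure on a fundamental domain. -/
theorem map_reduction_add_restrict {n : ℕ} (Λ : AddSubgroup (Fin n → ℝ)) [DiscreteTopology Λ]
    {F : Set (Fin n → ℝ)} (hF : MeasurableSet F)
    (hFfund : ∀ x : Fin n → ℝ, ∃! f, f ∈ F ∧ x - f ∈ Λ)
    {ψ : (Fin n → ℝ) → (Fin n → ℝ)} (hψmeas : Measurable ψ)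
    (hψ : ∀ x : Fin n → ℝ, ψ x ∈ F ∧ x - ψ x ∈ Λ) (x : Fin n → ℝ) :
    Measure.map (fun d => ψ (x + d)) (volume.restrict F) = volume.restrict F := by
  have : Countable Λ := TopologicalSpace.separableSpace_iff_countable.1 inferInstance
  have hfd := isAddFundamentalDomain_of_existsUnique_rep Λ hF hFfund
  have hψ_eq : ∀ {y f}, f ∈ F → y - f ∈ Λ → ψ y = f := fun {y f} hf hyf =>
    (hFfund y).unique (hψ y) ⟨hf, hyf⟩
  have hψ_vadd : ∀ (g : Λ) y, ψ (g +ᵥ y) = ψ y := fun g y =>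
    hψ_eq (hψ y).1 (by
      rw [AddSubgroup.vadd_def, vadd_eq_add, add_sub_assoc]
      exact Λ.add_mem g.2 (hψ y).2)
  have hmeas : Measurable fun d => ψ (x + d) := hψmeas.comp (measurable_const_add x)
  ext A hA
  rw [Measure.map_apply hmeas hA, Measure.restrict_apply (hmeas hA), Measure.restrict_apply hA]
  calc volume ((fun d => ψ (x + d)) ⁻¹' A ∩ F)
      = volume (x +ᵥ ((fun d => ψ (x + d)) ⁻¹' A ∩ F)) := (measure_vadd _ _ _).symm
    _ = volume (ψ ⁻¹' A ∩ (x +ᵥ F)) := by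
        congr 1
        ext y
        simp [Set.mem_vadd_set_iff_neg_vadd_mem]
    _ = volume (ψ ⁻¹' A ∩ F) :=
        (hfd.vadd_of_comm x).measure_set_eq hfd (hψmeas hA) fun g => by
          ext y
          simp only [Set.mem_preimage, hψ_vadd]
    _ = volume (A ∩ F) := by
        congr 1
        ext y
        refine and_congr_left fun hy => ?_
        rw [Set.mem_preimage, hψ_eq hy (by simp)]

/-- The dithered-quantization ("crypto") lemma: if `F` is a measurable fundamental domain of
a lattice `Λ ⊆ ℝⁿ` with finite positive volume, `ψ` is the reduction map onto `F`, `X` is any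
random vector and `D` is uniform on `F` and independent of `X`, then `ψ(X + D)` is uniform on
`F` and independent of `X`. -/
theorem crypto_lemma {n : ℕ} (Λ : AddSubgroup (Fin n → ℝ))
    (hΛdisc : DiscreteTopology Λ)
    (hΛspan : Submodule.span ℝ (Λ : Set (Fin n → ℝ)) = ⊤)
    (F : Set (Fin n → ℝ)) (hFmeas : MeasurableSet F)
    (hFpos : 0 < volume F) (hFfin : volume F < ⊤)
    (hFfund : ∀ x : Fin n → ℝ, ∃! f, f ∈ F ∧ x - f ∈ Λ)
    (ψ : (Fin n → ℝ) → (Fin n → ℝ)) (hψmeas : Measurable ψ)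
    (hψ : ∀ x : Fin n → ℝ, ψ x ∈ F ∧ x - ψ x ∈ Λ)
    {Ω : Type*} [MeasureSpace Ω] [IsProbabilityMeasure (ℙ : Measure Ω)]
    (X D : Ω → (Fin n → ℝ)) (hXmeas : Measurable X) (hDmeas : Measurable D)
    (hDunif : Measure.map D ℙ = (volume F)⁻¹ • volume.restrict F)
    (hindep : IndepFun X D ℙ) :
    Measure.map (fun ω => ψ (X ω + D ω)) ℙ = (volume F)⁻¹ • volume.restrict F ∧
    IndepFun X (fun ω => ψ (X ω + D ω)) ℙ := by
  have := hΛdisc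
  set U : Measure (Fin n → ℝ) := (volume F)⁻¹ • volume.restrict F with hU
  have : IsProbabilityMeasure U := hDunif ▸ Measure.isProbabilityMeasure_map hDmeas.aemeasurable
  have : IsProbabilityMeasure (Measure.map X ℙ) :=
    Measure.isProbabilityMeasure_map hXmeas.aemeasurable
  have hg : Measurable (Function.uncurry fun x d : Fin n → ℝ => ψ (x + d)) :=
    hψmeas.comp (measurable_fst.add measurable_snd)
  have hfib : ∀ x, Measure.map (fun d => ψ (x + d)) U = U := fun x => by
    rw [hU, Measure.map_smul,
      map_reduction_add_restrict Λ hFmeas hFfund hψmeas hψ x]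
  have hskew : MeasurePreserving (fun p : (Fin n → ℝ) × (Fin n → ℝ) => (p.1, ψ (p.1 + p.2)))
      ((Measure.map X ℙ).prod U) ((Measure.map X ℙ).prod U) :=
    (MeasurePreserving.id _).skew_product hg (Filter.Eventually.of_forall hfib)
  have hY : Measurable fun ω => ψ (X ω + D ω) := hψmeas.comp (hXmeas.add hDmeas)
  have hjoint : Measure.map (fun ω => (X ω, D ω)) ℙ = (Measure.map X ℙ).prod U := by
    rw [(indepFun_iff_map_prod_eq_prod_map_map hXmeas.aemeasurable hDmeas.aemeasurable).1 hindep,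
      hDunif]
  have hXY : Measure.map (fun ω => (X ω, ψ (X ω + D ω))) ℙ = (Measure.map X ℙ).prod U := by
    rw [← hskew.map_eq, ← hjoint, Measure.map_map hskew.measurable (hXmeas.prodMk hDmeas),
      Function.comp_def]
  have hYunif : Measure.map (fun ω => ψ (X ω + D ω)) ℙ = U := by
    rw [← Measure.snd_map_prodMk hXmeas, hXY, Measure.snd_prod]
  refine ⟨hYunif, ?_⟩
  rw [indepFun_iff_map_prod_eq_prod_map_map hXmeas.aemeasurable hY.aemeasurable, hXY, hYunif]
end
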